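/- For every a > 0 and b > 0 there exist constants C > 0 and ε₀ ∈ (0,1) such that the following holds. Let ε ∈ (0, ε₀], let ℓ ≥ 1 be an integer with log(1/ε) ≤ b ℓ, and let w ≤ a √(2ℓ+1). Then for every θ ∈ ℂ^{2ℓ+1} with ‖θ‖ ≤ w, log N(ε, {P_{θ,g} : g ∈ 𝔐([0,1])}, d_TV) ≤ C ℓ² ( log(1/ε) + log(ℓ+1) ), i.e. there exists a finite set S_θ of probability measures on ℂ^{2ℓ+1} with log |S_θ| ≤ C ℓ² ( log(1/ε) + log(ℓ+1) ) such that every P_{θ,g} with g ∈ 𝔐([0,1]) is within total variation distance ε of some element of S_θ. -/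

import Mathlib

open MeasureTheory Real Set

/-- squared Euclidean (Hermitian) norm on ℂ^p -/
noncomputable def sqnorm (p : ℕ) (z : Fin p → ℂ) : ℝ := ∑ i, ‖z i‖ ^ 2

/-- density of the standard complex Gaussian on ℂ^p centered at μ,
with respect to Lebesgue measure on ℂ^p ≃ ℝ^{2p} -/
noncomputable def cgauss (p : ℕ) (μ z : Fin p → ℂ) : ℝ :=
  (Real.pi ^ p)⁻¹ * Real.exp (-sqnorm p (z - μ))

/-- the rotated vector θ•φ, coordinates indexed by k = i - ℓ ∈ {-ℓ,…,ℓ} -/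
noncomputable def rot (ℓ : ℕ) (θ : Fin (2 * ℓ + 1) → ℂ) (φ : ℝ) : Fin (2 * ℓ + 1) → ℂ :=
  fun i => θ i * Complex.exp (-Complex.I * (2 * Real.pi * (((i : ℤ) - (ℓ : ℤ) : ℤ) : ℝ) * φ))

/-- the H1 norm ‖θ‖_{H1} = (Σ_k k²|θ_k|²)^{1/2} -/
noncomputable def H1norm (ℓ : ℕ) (θ : Fin (2 * ℓ + 1) → ℂ) : ℝ :=
  Real.sqrt (∑ i : Fin (2 * ℓ + 1), ((((i : ℤ) - (ℓ : ℤ) : ℤ) : ℝ)) ^ 2 * ‖θ i‖ ^ 2)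

/-- Hellinger distance between two (densities of) finite measures on ℂ^p -/
noncomputable def dHfin (p : ℕ) (q₁ q₂ : (Fin p → ℂ) → ℝ) : ℝ :=
  Real.sqrt (∫ z, (Real.sqrt (q₁ z) - Real.sqrt (q₂ z)) ^ 2)

/-- g is a Borel probability measure on [0,1] (encoded as a measure on ℝ carried by [0,1]) -/
def IsProbOn01 (g : MeasureTheory.Measure ℝ) : Prop :=
  MeasureTheory.IsProbabilityMeasure g ∧ g (Set.Icc 0 1) = 1

/-- density z ↦ ∫₀¹ γ(z − θ•φ) dg(φ) of the Gaussian mixture P_{θ,g} on ℂ^{2ℓ+1} -/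
noncomputable def mixDensity (ℓ : ℕ) (θ : Fin (2 * ℓ + 1) → ℂ) (g : Measure ℝ)
    (z : Fin (2 * ℓ + 1) → ℂ) : ℝ :=
  ∫ φ, cgauss (2 * ℓ + 1) (rot ℓ θ φ) z ∂g

/-- the Gaussian mixture measure P_{θ,g} on ℂ^{2ℓ+1} -/
noncomputable def mixMeasure (ℓ : ℕ) (θ : Fin (2 * ℓ + 1) → ℂ) (g : Measure ℝ) :
    Measure (Fin (2 * ℓ + 1) → ℂ) :=
  volume.withDensity (fun z => ENNReal.ofReal (mixDensity ℓ θ g z))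

/-- total variation distance between two measures: sup over measurable sets A
of |P(A) − Q(A)| -/
noncomputable def dTV {X : Type*} [MeasurableSpace X] (P Q : Measure X) : ℝ :=
  ⨆ (A : Set X) (_ : MeasurableSet A), |(P A).toReal - (Q A).toReal|


theorem card_le_of_separated_of_norm_le {ι E : Type*} [NormedAddCommGroup E] [NormedSpace ℝ E]
    [FiniteDimensional ℝ E] (t : Finset ι) (v : ι → E) {r δ : ℝ} (hδ : 0 < δ) (hr : 0 ≤ r)
    (hv : ∀ i ∈ t, ‖v i‖ ≤ r) (hsep : ∀ i ∈ t, ∀ j ∈ t, i ≠ j → 2 * δ ≤ ‖v i - v j‖) :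
    (t.card : ℝ) ≤ ((r + δ) / δ) ^ Module.finrank ℝ E := by
  borelize E
  let μ : Measure E := Measure.addHaar
  have hdisj : Set.Pairwise (t : Set ι)
      (Function.onFun Disjoint fun i => Metric.ball (v i) δ) := by
    intro i hi j hj hij
    apply Metric.ball_disjoint_ball
    rw [dist_eq_norm]
    linarith [hsep i hi j hj hij]
  have hsub : (⋃ i ∈ t, Metric.ball (v i) δ) ⊆ Metric.ball (0 : E) (r + δ) := by
    refine iUnion₂_subset fun i hi => Metric.ball_subset_ball' ?_
    rw [dist_zero_right]
    linarith [hv i hi]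
  have hvol : (t.card : ENNReal) * ENNReal.ofReal (δ ^ Module.finrank ℝ E) * μ (Metric.ball 0 1) ≤
      ENNReal.ofReal ((r + δ) ^ Module.finrank ℝ E) * μ (Metric.ball 0 1) :=
    calc
      _ = μ (⋃ i ∈ t, Metric.ball (v i) δ) := by
        rw [measure_biUnion_finset hdisj fun i _ => measurableSet_ball]
        simp only [μ.addHaar_ball_of_pos _ hδ, Finset.sum_const, nsmul_eq_mul, mul_assoc]
      _ ≤ μ (Metric.ball (0 : E) (r + δ)) := measure_mono hsub
      _ = _ := μ.addHaar_ball_of_pos _ (by positivity)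
  have hcard := (ENNReal.mul_le_mul_iff_left
    (Metric.measure_ball_pos μ (0 : E) zero_lt_one).ne' measure_ball_lt_top.ne).1 hvol
  have hreal := ENNReal.toReal_le_of_le_ofReal (by positivity) hcard
  rw [ENNReal.toReal_mul, ENNReal.toReal_natCast, ENNReal.toReal_ofReal (by positivity)] at hreal
  rw [div_pow, le_div_iff₀ (by positivity)]
  exact hreal

/-- A family in the unit ball that is uniformly close to a finite-dimensional subspace has a
small net made of its own members. -/
theorem exists_net_of_approx_submodule {ι E : Type*} [Nonempty ι] [NormedAddCommGroup E]
    [NormedSpace ℝ E] (W : Submodule ℝ E) [FiniteDimensional ℝ W] (v : ι → E) {δ : ℝ}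
    (hδ : 0 < δ) (hδ1 : δ ≤ 1) (hv : ∀ i, ‖v i‖ ≤ 1)
    (happrox : ∀ i, ∃ y ∈ W, ‖v i - y‖ ≤ δ / 4) :
    ∃ t : Finset ι, t.Nonempty ∧ (t.card : ℝ) ≤ (6 / δ) ^ Module.finrank ℝ W ∧
      ∀ i, ∃ j ∈ t, ‖v i - v j‖ ≤ δ := by
  classical
  choose y hyW hy using happrox
  let Sep (t : Finset ι) : Prop := ∀ i ∈ t, ∀ j ∈ t, i ≠ j → δ < ‖v i - v j‖
  have hbound : ∀ t, Sep t → (t.card : ℝ) ≤ (6 / δ) ^ Module.finrank ℝ W := by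
    intro t ht
    refine (card_le_of_separated_of_norm_le t (fun i => (⟨y i, hyW i⟩ : W)) (r := 5 / 4)
      (δ := δ / 4) (by positivity) (by norm_num) ?_ ?_).trans ?_
    · intro i _
      have : ‖y i‖ ≤ ‖v i‖ + ‖v i - y i‖ := by
        simpa using norm_sub_le (v i) (v i - y i)
      change ‖y i‖ ≤ _
      linarith [hv i, hy i]
    · intro i hi j hj hij
      have h1 : ‖v i - v j‖ ≤ ‖v i - y i‖ + ‖y i - y j‖ + ‖v j - y j‖ := by
        calc ‖v i - v j‖ = ‖(v i - y i) + (y i - y j) - (v j - y j)‖ := by congr 1; abel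
          _ ≤ _ := (norm_sub_le _ _).trans (by gcongr; exact norm_add_le _ _)
      change _ ≤ ‖y i - y j‖
      linarith [ht i hi j hj hij, hy i, hy j]
    · apply pow_le_pow_left₀ (by positivity)
      rw [div_le_div_iff₀ (by positivity) hδ]
      nlinarith
  have hnat : ∀ t, Sep t → t.card ≤ ⌊(6 / δ) ^ Module.finrank ℝ W⌋₊ := fun t ht =>
    Nat.le_floor (hbound t ht)
  let Q (n : ℕ) : Prop := ∃ t, Sep t ∧ t.card = n
  have hQ : Q (Nat.findGreatest Q ⌊(6 / δ) ^ Module.finrank ℝ W⌋₊) :=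
    Nat.findGreatest_spec (P := Q) (Nat.zero_le _) ⟨∅, by simp [Sep], rfl⟩
  obtain ⟨t, ht, htc⟩ := hQ
  have hcover : ∀ i, ∃ j ∈ t, ‖v i - v j‖ ≤ δ := by
    intro i
    by_contra! hcon
    have hit : i ∉ t := fun h => by
      have := hcon i h
      simp at this
      linarith
    have hins : Sep (insert i t) := by
      intro k hk l hl hkl
      rcases Finset.mem_insert.1 hk with hk | hk <;>
        rcases Finset.mem_insert.1 hl with hl | hl
      · exact absurd (hk.trans hl.symm) hkl
      · rw [hk]; exact hcon l hl
      · rw [hl, norm_sub_rev]; exact hcon k hk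
      · exact ht k hk l hl hkl
    have := Nat.le_findGreatest (P := Q) (hnat _ hins) ⟨_, hins, rfl⟩
    rw [Finset.card_insert_of_notMem hit] at this
    omega
  refine ⟨t, ?_, hbound t ht, hcover⟩
  obtain ⟨j, hj, -⟩ := hcover (Classical.arbitrary ι)
  exact ⟨j, hj⟩

/-- Lagrange interpolation for real trigonometric polynomials of degree at most `N`. -/
theorem exists_trig_interpolation (N : ℕ) :
    ∃ (node : Fin (2 * N + 1) → ℝ) (w : Fin (2 * N + 1) → ℝ → ℝ), (∀ j, Continuous (w j)) ∧
      ∀ (R : Polynomial ℂ) (f : ℝ → ℝ), R.natDegree ≤ 2 * N →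
        (∀ φ : ℝ, (f φ : ℂ) * Complex.exp (2 * π * Complex.I * φ) ^ N
          = R.eval (Complex.exp (2 * π * Complex.I * φ))) →
        ∀ φ, f φ = ∑ j, w j φ * f (node j) := by
  classical
  let u (φ : ℝ) : ℂ := Complex.exp (2 * π * Complex.I * φ)
  have hu : Continuous u := by fun_prop
  have hu0 : ∀ φ, u φ ≠ 0 := fun φ => Complex.exp_ne_zero _
  let node (j : Fin (2 * N + 1)) : ℝ := (j : ℝ) / (2 * N + 1 : ℕ)
  have hinj : Function.Injective fun j => u (node j) := by
    intro i j hij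
    have hprim := Complex.isPrimitiveRoot_exp (2 * N + 1) (by omega)
    have hpow : ∀ k : Fin (2 * N + 1), u (node k) =
        Complex.exp (2 * π * Complex.I / (2 * N + 1 : ℕ)) ^ (k : ℕ) := by
      intro k
      rw [← Complex.exp_nat_mul]
      simp only [u, node]
      congr 1
      push_cast
      ring
    simp only [hpow] at hij
    exact Fin.ext (hprim.pow_inj i.2 j.2 hij)
  let L (j : Fin (2 * N + 1)) : Polynomial ℂ :=
    Lagrange.basis Finset.univ (fun k => u (node k)) j
  refine ⟨node, fun j φ => ((L j).eval (u φ) * u (node j) ^ N / u φ ^ N).re, ?_, ?_⟩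
  · intro j
    refine Complex.continuous_re.comp (Continuous.div ?_ (hu.pow N) fun φ => pow_ne_zero _ (hu0 φ))
    exact ((L j).continuous.comp hu).mul continuous_const
  · intro R f hR hf φ
    have hdeg : R.degree < (Finset.univ : Finset (Fin (2 * N + 1))).card := by
      rw [Finset.card_univ, Fintype.card_fin]
      exact lt_of_le_of_lt Polynomial.degree_le_natDegree (by exact_mod_cast Nat.lt_succ_of_le hR)
    have hint := congrArg (Polynomial.eval (u φ))
      (Lagrange.eq_interpolate (s := Finset.univ) (v := fun k => u (node k)) hinj.injOn hdeg)
    rw [Lagrange.interpolate_apply, Polynomial.eval_finsetSum] at hint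
    have hf' : ∀ φ, (f φ : ℂ) * u φ ^ N = R.eval (u φ) := hf
    have hcomplex : (f φ : ℂ) =
        ∑ j, ((L j).eval (u φ) * u (node j) ^ N / u φ ^ N) * (f (node j) : ℂ) := by
      rw [eq_div_of_mul_eq (pow_ne_zero _ (hu0 φ)) (hf' φ), hint, Finset.sum_div]
      refine Finset.sum_congr rfl fun j _ => ?_
      rw [Polynomial.eval_mul, Polynomial.eval_C, ← hf' (node j)]
      ring
    have := congrArg Complex.re hcomplex
    rw [Complex.ofReal_re, Complex.re_sum] at this
    rw [this]
    exact Finset.sum_congr rfl fun j _ => Complex.re_mul_ofReal _ _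

theorem abs_sum_range_pow_div_factorial_le_exp (x : ℝ) (n : ℕ) :
    |∑ m ∈ Finset.range n, x ^ m / (m.factorial : ℝ)| ≤ Real.exp |x| := by
  refine (Finset.abs_sum_le_sum_abs _ _).trans ?_
  simp only [abs_div, abs_pow, Nat.abs_cast]
  exact Real.sum_le_exp_of_nonneg (abs_nonneg x) n

/-- Chernoff-type bound for the tail of the exponential series. -/
theorem abs_exp_sub_sum_range_le (x : ℝ) (n : ℕ) :
    |Real.exp x - ∑ m ∈ Finset.range n, x ^ m / (m.factorial : ℝ)| ≤
      Real.exp (-n) * Real.exp (Real.exp 1 * |x|) := by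
  have hs : ∀ y : ℝ, HasSum (fun m : ℕ => y ^ m / (m.factorial : ℝ)) (Real.exp y) := fun y => by
    rw [Real.exp_eq_exp_ℝ]
    exact NormedSpace.expSeries_div_hasSum_exp y
  have htail := (hasSum_nat_add_iff' n).2 (hs x)
  have hbig : HasSum (fun m : ℕ => Real.exp (-n) * ((Real.exp 1 * |x|) ^ m / (m.factorial : ℝ)))
      (Real.exp (-n) * Real.exp (Real.exp 1 * |x|)) := (hs _).mul_left _
  have hshift := (summable_nat_add_iff n).2 hbig.summable
  rw [← htail.tsum_eq, ← hbig.tsum_eq, ← Real.norm_eq_abs]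
  refine (tsum_of_norm_bounded hshift.hasSum fun m => ?_).trans ?_
  · rw [Real.norm_eq_abs, abs_div, abs_pow, Nat.abs_cast, mul_pow, mul_div_assoc, ← mul_assoc]
    refine le_mul_of_one_le_left (by positivity) ?_
    rw [← Real.exp_nat_mul, ← Real.exp_add, Real.one_le_exp_iff]
    push_cast
    linarith [(Nat.cast_nonneg m : (0 : ℝ) ≤ m)]
  · rw [← hbig.summable.sum_add_tsum_nat_add n]
    exact le_add_of_nonneg_left (Finset.sum_nonneg fun m _ => by positivity)

theorem sqnorm_nonneg (p : ℕ) (z : Fin p → ℂ) : 0 ≤ sqnorm p z :=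
  Finset.sum_nonneg fun _ _ => by positivity

theorem continuous_sqnorm (p : ℕ) : Continuous (sqnorm p) := by
  unfold sqnorm
  fun_prop

theorem continuous_rot (ℓ : ℕ) (θ : Fin (2 * ℓ + 1) → ℂ) : Continuous (rot ℓ θ) := by
  unfold rot
  fun_prop

theorem sqnorm_sub (p : ℕ) (z r : Fin p → ℂ) :
    sqnorm p (z - r) =
      sqnorm p z + sqnorm p r - 2 * (∑ i, z i * (starRingEnd ℂ) (r i)).re := by
  simp only [sqnorm, Pi.sub_apply, Complex.re_sum, Finset.mul_sum, ← Finset.sum_add_distrib,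
    ← Finset.sum_sub_distrib, ← Complex.normSq_eq_norm_sq, Complex.normSq_sub]

theorem norm_rot (ℓ : ℕ) (θ : Fin (2 * ℓ + 1) → ℂ) (φ : ℝ) (i : Fin (2 * ℓ + 1)) :
    ‖rot ℓ θ φ i‖ = ‖θ i‖ := by
  rw [rot, norm_mul, Complex.norm_exp]
  simp

/-- The cross term `2 Re ⟨z, θ•φ⟩` of `‖z - θ•φ‖²`. -/
noncomputable def crossTerm (ℓ : ℕ) (θ : Fin (2 * ℓ + 1) → ℂ) (φ : ℝ)
    (z : Fin (2 * ℓ + 1) → ℂ) : ℝ :=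
  2 * (∑ i, z i * (starRingEnd ℂ) (rot ℓ θ φ i)).re

theorem continuous_crossTerm (ℓ : ℕ) (θ : Fin (2 * ℓ + 1) → ℂ) (φ : ℝ) :
    Continuous (crossTerm ℓ θ φ) := by
  unfold crossTerm
  fun_prop

theorem mul_abs_crossTerm_le (ℓ : ℕ) (θ : Fin (2 * ℓ + 1) → ℂ) (φ : ℝ)
    (z : Fin (2 * ℓ + 1) → ℂ) {c : ℝ} (hc : 0 ≤ c) :
    c * |crossTerm ℓ θ φ z| ≤ sqnorm _ z / 2 + 2 * c ^ 2 * sqnorm _ θ := by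
  have h : |(∑ i, z i * (starRingEnd ℂ) (rot ℓ θ φ i)).re| ≤ ∑ i, ‖z i‖ * ‖θ i‖ := by
    refine (Complex.abs_re_le_norm _).trans ((norm_sum_le _ _).trans (le_of_eq ?_))
    simp [norm_rot]
  calc c * |crossTerm ℓ θ φ z| ≤ c * (2 * ∑ i, ‖z i‖ * ‖θ i‖) := by
        rw [crossTerm, abs_mul, abs_two]
        gcongr
    _ = ∑ i, 2 * c * (‖z i‖ * ‖θ i‖) := by rw [← mul_assoc, Finset.mul_sum]; ring_nf
    _ ≤ ∑ i, (‖z i‖ ^ 2 / 2 + 2 * c ^ 2 * ‖θ i‖ ^ 2) :=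
        Finset.sum_le_sum fun i _ => by nlinarith [sq_nonneg (‖z i‖ - 2 * c * ‖θ i‖)]
    _ = _ := by rw [Finset.sum_add_distrib, ← Finset.sum_div, ← Finset.mul_sum]; rfl

/-- The factor `π^{-p} e^{-‖z‖² - ‖θ‖²}` of the density of a rotated Gaussian. -/
noncomputable def baseWeight (p : ℕ) (θ z : Fin p → ℂ) : ℝ :=
  (π ^ p)⁻¹ * Real.exp (-sqnorm p z - sqnorm p θ)

theorem baseWeight_nonneg (p : ℕ) (θ z : Fin p → ℂ) : 0 ≤ baseWeight p θ z := by
  unfold baseWeight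
  positivity

theorem continuous_baseWeight (p : ℕ) (θ : Fin p → ℂ) : Continuous (baseWeight p θ) := by
  have := continuous_sqnorm p
  unfold baseWeight
  fun_prop

theorem cgauss_rot (ℓ : ℕ) (θ : Fin (2 * ℓ + 1) → ℂ) (φ : ℝ) (z : Fin (2 * ℓ + 1) → ℂ) :
    cgauss (2 * ℓ + 1) (rot ℓ θ φ) z =
      baseWeight _ θ z * Real.exp (crossTerm ℓ θ φ z) := by
  have hr : sqnorm (2 * ℓ + 1) (rot ℓ θ φ) = sqnorm _ θ := by simp [sqnorm, norm_rot]
  rw [cgauss, baseWeight, crossTerm, sqnorm_sub, hr, mul_assoc, ← Real.exp_add]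
  congr 2
  ring

/-- The density of a rotated Gaussian with the exponential of the cross term truncated. -/
noncomputable def truncGauss (K ℓ : ℕ) (θ : Fin (2 * ℓ + 1) → ℂ) (φ : ℝ)
    (z : Fin (2 * ℓ + 1) → ℂ) : ℝ :=
  baseWeight _ θ z * ∑ m ∈ Finset.range K, crossTerm ℓ θ φ z ^ m / (m.factorial : ℝ)

theorem continuous_truncGauss (K ℓ : ℕ) (θ : Fin (2 * ℓ + 1) → ℂ) (φ : ℝ) :
    Continuous (truncGauss K ℓ θ φ) := by
  have h₁ := continuous_crossTerm ℓ θ φ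
  have h₂ := continuous_baseWeight _ θ
  unfold truncGauss
  fun_prop

/-- A dominating Gaussian profile, of total mass `B · 2^p`. -/
noncomputable def wideGauss (p : ℕ) (B : ℝ) (z : Fin p → ℂ) : ℝ :=
  B * ((π ^ p)⁻¹ * Real.exp (-sqnorm p z / 2))

theorem baseWeight_mul_exp_le (ℓ : ℕ) (θ : Fin (2 * ℓ + 1) → ℂ) (φ : ℝ)
    (z : Fin (2 * ℓ + 1) → ℂ) {c : ℝ} (hc : 0 ≤ c) :
    baseWeight _ θ z * Real.exp (c * |crossTerm ℓ θ φ z|) ≤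
      wideGauss _ (Real.exp (2 * c ^ 2 * sqnorm _ θ)) z := by
  rw [baseWeight, wideGauss, mul_left_comm (Real.exp _), mul_assoc, ← Real.exp_add,
    ← Real.exp_add]
  refine mul_le_mul_of_nonneg_left (Real.exp_le_exp.2 ?_) (by positivity)
  linarith [mul_abs_crossTerm_le ℓ θ φ z hc, sqnorm_nonneg _ θ]

theorem abs_truncGauss_le (K ℓ : ℕ) (θ : Fin (2 * ℓ + 1) → ℂ) (φ : ℝ)
    (z : Fin (2 * ℓ + 1) → ℂ) :
    |truncGauss K ℓ θ φ z| ≤ wideGauss _ (Real.exp (2 * sqnorm _ θ)) z := by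
  rw [truncGauss, abs_mul, abs_of_nonneg (baseWeight_nonneg _ _ _)]
  refine (mul_le_mul_of_nonneg_left (abs_sum_range_pow_div_factorial_le_exp _ _)
    (baseWeight_nonneg _ _ _)).trans ?_
  simpa using baseWeight_mul_exp_le ℓ θ φ z zero_le_one

theorem abs_cgauss_rot_sub_truncGauss_le (K ℓ : ℕ) (θ : Fin (2 * ℓ + 1) → ℂ) (φ : ℝ)
    (z : Fin (2 * ℓ + 1) → ℂ) :
    |cgauss (2 * ℓ + 1) (rot ℓ θ φ) z - truncGauss K ℓ θ φ z| ≤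
      wideGauss _ (Real.exp (-K) * Real.exp (18 * sqnorm _ θ)) z := by
  rw [cgauss_rot, truncGauss, ← mul_sub, abs_mul, abs_of_nonneg (baseWeight_nonneg _ _ _)]
  refine (mul_le_mul_of_nonneg_left (abs_exp_sub_sum_range_le _ _)
    (baseWeight_nonneg _ _ _)).trans ?_
  rw [mul_left_comm]
  have h := baseWeight_mul_exp_le ℓ θ φ z (Real.exp_pos 1).le
  refine (mul_le_mul_of_nonneg_left h (Real.exp_pos _).le).trans ?_
  rw [wideGauss, wideGauss, ← mul_assoc]
  gcongr
  · exact sqnorm_nonneg _ _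
  · nlinarith [Real.exp_one_lt_three, Real.exp_pos 1]

theorem integrable_exp_neg_mul_sqnorm (p : ℕ) {b : ℝ} (hb : 0 < b) :
    Integrable (fun z : Fin p → ℂ => Real.exp (-b * sqnorm p z)) := by
  have h : Integrable (fun z : ℂ => Real.exp (-b * ‖z‖ ^ 2)) := by
    by_contra hn
    have := GaussianFourier.integral_rexp_neg_mul_sq_norm (V := ℂ) hb
    rw [integral_undef hn] at this
    have : 0 < (π / b) ^ ((Module.finrank ℝ ℂ : ℝ) / 2) := by positivity
    linarith
  have := Integrable.fintype_prod (ι := Fin p) (f := fun _ (z : ℂ) => Real.exp (-b * ‖z‖ ^ 2))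
    (μ := fun _ => volume) fun _ => h
  simpa only [sqnorm, Finset.mul_sum, Real.exp_sum, volume_pi] using this

theorem integral_exp_neg_mul_sqnorm (p : ℕ) {b : ℝ} (hb : 0 < b) :
    ∫ z : Fin p → ℂ, Real.exp (-b * sqnorm p z) = (π / b) ^ p := by
  have h := integral_fintype_prod_volume_eq_pow (ι := Fin p)
    (fun z : ℂ => Real.exp (-b * ‖z‖ ^ 2))
  rw [GaussianFourier.integral_rexp_neg_mul_sq_norm hb] at h
  simpa only [sqnorm, Finset.mul_sum, Real.exp_sum, Complex.finrank_real_complex, Nat.cast_ofNat,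
    div_self (two_ne_zero' ℝ), Real.rpow_one, Fintype.card_fin] using h

theorem integrable_wideGauss (p : ℕ) (B : ℝ) : Integrable (wideGauss p B) := by
  have h := (integrable_exp_neg_mul_sqnorm p (b := 1 / 2) (by norm_num)).const_mul
    (B * (π ^ p)⁻¹)
  refine h.congr (ae_of_all _ fun z => ?_)
  simp only [wideGauss, mul_assoc]
  ring_nf

theorem integral_wideGauss (p : ℕ) (B : ℝ) : ∫ z, wideGauss p B z = B * 2 ^ p := by
  have h := integral_exp_neg_mul_sqnorm p (b := 1 / 2) (by norm_num)
  have hfun : wideGauss p B = fun z => (B * (π ^ p)⁻¹) * Real.exp (-(1 / 2) * sqnorm p z) := by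
    funext z
    simp only [wideGauss, mul_assoc]
    ring_nf
  rw [hfun, integral_const_mul, h]
  have : π ^ p ≠ 0 := by positivity
  rw [show π / (1 / 2) = π * 2 by ring, mul_pow]
  field_simp

theorem cgauss_nonneg (p : ℕ) (μ z : Fin p → ℂ) : 0 ≤ cgauss p μ z := by
  unfold cgauss
  positivity

theorem integrable_cgauss (p : ℕ) (μ : Fin p → ℂ) : Integrable (cgauss p μ) := by
  have h := ((integrable_exp_neg_mul_sqnorm p one_pos).comp_sub_right μ).const_mul (π ^ p)⁻¹
  simp only [neg_one_mul] at h
  exact h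

theorem integral_cgauss (p : ℕ) (μ : Fin p → ℂ) : ∫ z, cgauss p μ z = 1 := by
  have h := integral_exp_neg_mul_sqnorm p one_pos
  have hπ : π ^ p ≠ 0 := by positivity
  simp only [cgauss, integral_const_mul]
  rw [integral_sub_right_eq_self (fun z => Real.exp (-sqnorm p z)) μ]
  simp only [neg_one_mul, div_one] at h
  rw [h, inv_mul_cancel₀ hπ]

theorem exists_polynomial_crossTerm (ℓ : ℕ) (θ z : Fin (2 * ℓ + 1) → ℂ) :
    ∃ Q : Polynomial ℂ, Q.natDegree ≤ 2 * ℓ ∧ ∀ φ : ℝ,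
      (crossTerm ℓ θ φ z : ℂ) * Complex.exp (2 * π * Complex.I * φ) ^ ℓ
        = Q.eval (Complex.exp (2 * π * Complex.I * φ)) := by
  refine ⟨∑ i : Fin (2 * ℓ + 1),
    (Polynomial.C (z i * (starRingEnd ℂ) (θ i)) * Polynomial.X ^ (i : ℕ) +
      Polynomial.C ((starRingEnd ℂ) (z i) * θ i) * Polynomial.X ^ (2 * ℓ - (i : ℕ))), ?_, ?_⟩
  · refine Polynomial.natDegree_sum_le_of_forall_le _ _ fun i _ => ?_
    refine Polynomial.natDegree_add_le_of_degree_le ?_ ?_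
    · exact (Polynomial.natDegree_C_mul_X_pow_le _ _).trans (by omega)
    · exact (Polynomial.natDegree_C_mul_X_pow_le _ _).trans (by omega)
  · intro φ
    have hx : (crossTerm ℓ θ φ z : ℂ) = ∑ i, (z i * (starRingEnd ℂ) (rot ℓ θ φ i) +
        (starRingEnd ℂ) (z i) * rot ℓ θ φ i) := by
      rw [crossTerm, Complex.re_sum, Finset.mul_sum, Complex.ofReal_sum]
      refine Finset.sum_congr rfl fun i _ => ?_
      have := Complex.add_conj (z i * (starRingEnd ℂ) (rot ℓ θ φ i))
      rw [map_mul, Complex.conj_conj] at this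
      exact this.symm
    rw [hx, Finset.sum_mul, Polynomial.eval_finsetSum]
    refine Finset.sum_congr rfl fun i _ => ?_
    have hi : (i : ℕ) ≤ 2 * ℓ := by omega
    have hrot : rot ℓ θ φ i * Complex.exp (2 * π * Complex.I * φ) ^ ℓ =
        θ i * Complex.exp (2 * π * Complex.I * φ) ^ (2 * ℓ - (i : ℕ)) := by
      rw [rot, mul_assoc, ← Complex.exp_nat_mul, ← Complex.exp_nat_mul, ← Complex.exp_add]
      congr 2
      push_cast [Nat.cast_sub hi]
      ring
    have hrot' : (starRingEnd ℂ) (rot ℓ θ φ i) * Complex.exp (2 * π * Complex.I * φ) ^ ℓ =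
        (starRingEnd ℂ) (θ i) * Complex.exp (2 * π * Complex.I * φ) ^ (i : ℕ) := by
      rw [rot, map_mul, ← Complex.exp_conj, mul_assoc, ← Complex.exp_nat_mul,
        ← Complex.exp_nat_mul, ← Complex.exp_add]
      congr 2
      simp only [map_mul, map_neg, Complex.conj_I, Complex.conj_ofReal, map_ofNat]
      push_cast
      ring
    simp only [Polynomial.eval_add, Polynomial.eval_mul, Polynomial.eval_C, Polynomial.eval_pow,
      Polynomial.eval_X]
    rw [add_mul, mul_assoc, hrot', mul_assoc ((starRingEnd ℂ) (z i)), hrot]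
    ring

theorem exists_truncGauss_interpolation (K ℓ : ℕ) (θ : Fin (2 * ℓ + 1) → ℂ) :
    ∃ (node : Fin (2 * (ℓ * K) + 1) → ℝ) (w : Fin (2 * (ℓ * K) + 1) → ℝ → ℝ),
      (∀ j, Continuous (w j)) ∧ ∀ φ z,
        truncGauss K ℓ θ φ z = ∑ j, w j φ * truncGauss K ℓ θ (node j) z := by
  obtain ⟨node, w, hw, hinterp⟩ := exists_trig_interpolation (ℓ * K)
  refine ⟨node, w, hw, fun φ z => ?_⟩
  obtain ⟨Q, hQdeg, hQ⟩ := exists_polynomial_crossTerm ℓ θ z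
  have h := hinterp
    (∑ m ∈ Finset.range K, Polynomial.C ((m.factorial : ℂ)⁻¹) *
      (Q ^ m * Polynomial.X ^ (ℓ * (K - m))))
    (fun φ => ∑ m ∈ Finset.range K, crossTerm ℓ θ φ z ^ m / (m.factorial : ℝ)) ?_ ?_ φ
  · simp only [truncGauss]
    rw [h, Finset.mul_sum]
    exact Finset.sum_congr rfl fun j _ => mul_left_comm _ _ _
  · refine Polynomial.natDegree_sum_le_of_forall_le _ _ fun m hm => ?_
    have hmK : m ≤ K := (Finset.mem_range.1 hm).le
    refine (Polynomial.natDegree_C_mul_le _ _).trans (Polynomial.natDegree_mul_le.trans ?_)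
    rw [Polynomial.natDegree_X_pow]
    have h₁ : (Q ^ m).natDegree ≤ m * (2 * ℓ) :=
      Polynomial.natDegree_pow_le.trans (Nat.mul_le_mul_left m hQdeg)
    obtain ⟨d, rfl⟩ := Nat.exists_eq_add_of_le hmK
    rw [Nat.add_sub_cancel_left]
    nlinarith [Nat.zero_le (ℓ * d)]
  · intro φ
    rw [Polynomial.eval_finsetSum, Complex.ofReal_sum, Finset.sum_mul]
    refine Finset.sum_congr rfl fun m hm => ?_
    have hmK : m ≤ K := (Finset.mem_range.1 hm).le
    simp only [Polynomial.eval_mul, Polynomial.eval_C, Polynomial.eval_pow, Polynomial.eval_X]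
    rw [← hQ, mul_pow, ← pow_mul, mul_assoc (_ ^ m), ← pow_add,
      ← mul_add, Nat.add_sub_cancel' hmK]
    push_cast
    ring

theorem IsProbOn01.integrable_of_continuous {g : Measure ℝ} (hg : IsProbOn01 g) {f : ℝ → ℝ}
    (hf : Continuous f) : Integrable f g := by
  have := hg.1
  have hr : g.restrict (Icc 0 1) = g := by
    refine Measure.restrict_eq_self_of_ae_mem ?_
    exact (prob_compl_eq_zero_iff measurableSet_Icc).2 hg.2
  rw [← hr]
  exact hf.continuousOn.integrableOn_compact isCompact_Icc

theorem sum_smul_toL1 {α ι : Type*} [Fintype ι] [MeasurableSpace α] {μ : Measure α}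
    (c : ι → ℝ) {h : ι → α → ℝ} (hh : ∀ j, Integrable (h j) μ)
    (hsum : Integrable (fun a => ∑ j, c j * h j a) μ) :
    ∑ j, c j • (hh j).toL1 = hsum.toL1 := by
  refine Lp.ext ((Lp.coeFn_finsetSum _ _).trans ?_)
  have hall : ∀ j, (c j • (hh j).toL1 : Lp ℝ 1 μ) =ᵐ[μ] fun a => c j * h j a := fun j =>
    Integrable.coeFn_toL1 ((hh j).const_mul (c j))
  filter_upwards [hsum.coeFn_toL1, ae_all_iff.2 hall] with z h₁ h₂
  rw [h₁, Finset.sum_apply]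
  exact Finset.sum_congr rfl fun j _ => h₂ j

section Mixture

variable (ℓ : ℕ) (θ : Fin (2 * ℓ + 1) → ℂ)

theorem continuous_cgauss_rot :
    Continuous fun x : (Fin (2 * ℓ + 1) → ℂ) × ℝ => cgauss (2 * ℓ + 1) (rot ℓ θ x.2) x.1 := by
  have h₁ := continuous_sqnorm (2 * ℓ + 1)
  have h₂ := continuous_rot ℓ θ
  unfold cgauss
  fun_prop

theorem integrable_cgauss_rot_prod (g : Measure ℝ) [IsProbabilityMeasure g] :
    Integrable (fun x : (Fin (2 * ℓ + 1) → ℂ) × ℝ => cgauss (2 * ℓ + 1) (rot ℓ θ x.2) x.1)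
      (volume.prod g) := by
  rw [integrable_prod_iff' (continuous_cgauss_rot ℓ θ).aestronglyMeasurable]
  refine ⟨ae_of_all _ fun φ => integrable_cgauss (2 * ℓ + 1) (rot ℓ θ φ), ?_⟩
  simp only [Real.norm_eq_abs, abs_of_nonneg (cgauss_nonneg _ _ _), integral_cgauss]
  exact integrable_const 1

theorem integrable_mixDensity (g : Measure ℝ) [IsProbabilityMeasure g] :
    Integrable (mixDensity ℓ θ g) :=
  (integrable_cgauss_rot_prod ℓ θ g).integral_prod_left

theorem integral_mixDensity (g : Measure ℝ) [IsProbabilityMeasure g] :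
    ∫ z, mixDensity ℓ θ g z = 1 := by
  simp only [mixDensity]
  rw [integral_integral_swap (integrable_cgauss_rot_prod ℓ θ g)]
  simp [integral_cgauss]

theorem mixDensity_nonneg (g : Measure ℝ) (z : Fin (2 * ℓ + 1) → ℂ) : 0 ≤ mixDensity ℓ θ g z :=
  integral_nonneg fun _ => cgauss_nonneg _ _ _

theorem toReal_mixMeasure_apply (g : Measure ℝ) [IsProbabilityMeasure g]
    {A : Set (Fin (2 * ℓ + 1) → ℂ)} (hA : MeasurableSet A) :
    (mixMeasure ℓ θ g A).toReal = ∫ z in A, mixDensity ℓ θ g z := by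
  rw [mixMeasure, withDensity_apply _ hA, integral_eq_lintegral_of_nonneg_ae
    (ae_of_all _ (mixDensity_nonneg ℓ θ g)) (integrable_mixDensity ℓ θ g).1.restrict]

theorem isProbabilityMeasure_mixMeasure (g : Measure ℝ) [IsProbabilityMeasure g] :
    IsProbabilityMeasure (mixMeasure ℓ θ g) := by
  constructor
  rw [mixMeasure, withDensity_apply _ MeasurableSet.univ, Measure.restrict_univ,
    ← ofReal_integral_eq_lintegral_ofReal (integrable_mixDensity ℓ θ g)
      (ae_of_all _ (mixDensity_nonneg ℓ θ g)), integral_mixDensity, ENNReal.ofReal_one]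

theorem dTV_mixMeasure_le (g g' : Measure ℝ) [IsProbabilityMeasure g] [IsProbabilityMeasure g'] :
    dTV (mixMeasure ℓ θ g) (mixMeasure ℓ θ g') ≤
      ‖(integrable_mixDensity ℓ θ g).toL1 - (integrable_mixDensity ℓ θ g').toL1‖ := by
  have hi := integrable_mixDensity ℓ θ g
  have hi' := integrable_mixDensity ℓ θ g'
  refine Real.iSup_le (fun A => Real.iSup_le (fun hA => ?_) (norm_nonneg _)) (norm_nonneg _)
  rw [toReal_mixMeasure_apply ℓ θ g hA, toReal_mixMeasure_apply ℓ θ g' hA,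
    ← integral_sub hi.integrableOn hi'.integrableOn, ← Integrable.toL1_sub _ _ hi hi',
    L1.norm_of_fun_eq_integral_norm]
  exact (norm_integral_le_integral_norm _).trans
    (setIntegral_le_integral (hi.sub hi').norm (ae_of_all _ fun _ => norm_nonneg _))

theorem integrable_truncGauss (K : ℕ) (φ : ℝ) : Integrable (truncGauss K ℓ θ φ) :=
  (integrable_wideGauss _ _).mono' (continuous_truncGauss K ℓ θ φ).aestronglyMeasurable
    (ae_of_all _ fun z => abs_truncGauss_le K ℓ θ φ z)

theorem norm_toL1_mixDensity (g : Measure ℝ) [IsProbabilityMeasure g] :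
    ‖(integrable_mixDensity ℓ θ g).toL1‖ = 1 := by
  rw [L1.norm_of_fun_eq_integral_norm]
  simp only [Real.norm_eq_abs, abs_of_nonneg (mixDensity_nonneg ℓ θ g _), integral_mixDensity]


theorem abs_mixDensity_sub_le (K : ℕ) {ι : Type*} [Fintype ι] {node : ι → ℝ} {w : ι → ℝ → ℝ}
    (hw : ∀ j, Continuous (w j))
    (hinterp : ∀ φ z, truncGauss K ℓ θ φ z = ∑ j, w j φ * truncGauss K ℓ θ (node j) z)
    {g : Measure ℝ} (hg : IsProbOn01 g) (z : Fin (2 * ℓ + 1) → ℂ) :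
    |mixDensity ℓ θ g z - ∑ j, (∫ φ, w j φ ∂g) * truncGauss K ℓ θ (node j) z| ≤
      wideGauss (2 * ℓ + 1) (Real.exp (-K) * Real.exp (18 * sqnorm _ θ)) z := by
  have := hg.1
  have hiw : ∀ j ∈ Finset.univ, Integrable (fun φ => w j φ * truncGauss K ℓ θ (node j) z) g :=
    fun j _ => (hg.integrable_of_continuous (hw j)).mul_const _
  have hrepr : (fun φ => truncGauss K ℓ θ φ z) =
      fun φ => ∑ j, w j φ * truncGauss K ℓ θ (node j) z := funext fun φ => hinterp φ z
  have htrunc : ∑ j, (∫ φ, w j φ ∂g) * truncGauss K ℓ θ (node j) z =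
      ∫ φ, truncGauss K ℓ θ φ z ∂g := by
    rw [hrepr, integral_finsetSum _ hiw]
    simp only [integral_mul_const]
  have hti : Integrable (fun φ => truncGauss K ℓ θ φ z) g := by
    rw [hrepr]
    exact integrable_finsetSum _ hiw
  have hci : Integrable (fun φ => cgauss (2 * ℓ + 1) (rot ℓ θ φ) z) g :=
    hg.integrable_of_continuous <| by
      have h₁ := continuous_sqnorm (2 * ℓ + 1)
      have h₂ := continuous_rot ℓ θ
      unfold cgauss
      fun_prop
  rw [htrunc, mixDensity, ← integral_sub hci hti]
  have hpt : ∀ φ, ‖cgauss (2 * ℓ + 1) (rot ℓ θ φ) z - truncGauss K ℓ θ φ z‖ ≤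
      wideGauss (2 * ℓ + 1) (Real.exp (-K) * Real.exp (18 * sqnorm _ θ)) z := fun φ => by
    rw [Real.norm_eq_abs]
    exact abs_cgauss_rot_sub_truncGauss_le K ℓ θ φ z
  have h := norm_integral_le_of_norm_le_const (μ := g) (ae_of_all _ hpt)
  rwa [probReal_univ, mul_one] at h

/-- All mixtures lie close to a single subspace of dimension at most `2ℓK + 1`. -/
theorem exists_submodule_approx_mixDensity (K : ℕ) :
    ∃ W : Submodule ℝ (Lp ℝ 1 (volume : Measure (Fin (2 * ℓ + 1) → ℂ))),
      FiniteDimensional ℝ W ∧ Module.finrank ℝ W ≤ 2 * (ℓ * K) + 1 ∧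
      ∀ (g : Measure ℝ) (hg : IsProbOn01 g),
        have := hg.1
        ∃ y ∈ W, ‖(integrable_mixDensity ℓ θ g).toL1 - y‖ ≤
          Real.exp (-K) * Real.exp (18 * sqnorm _ θ) * 2 ^ (2 * ℓ + 1) := by
  obtain ⟨node, w, hw, hinterp⟩ := exists_truncGauss_interpolation K ℓ θ
  let e (j : Fin (2 * (ℓ * K) + 1)) : Lp ℝ 1 (volume : Measure (Fin (2 * ℓ + 1) → ℂ)) :=
    (integrable_truncGauss ℓ θ K (node j)).toL1
  refine ⟨Submodule.span ℝ (range e), FiniteDimensional.span_of_finite ℝ (finite_range e),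
    (finrank_range_le_card e).trans (by simp), ?_⟩
  intro g hg hgp
  have hmix := integrable_mixDensity ℓ θ g
  have hterm : ∀ j ∈ Finset.univ, Integrable fun z =>
      (∫ φ, w j φ ∂g) * truncGauss K ℓ θ (node j) z :=
    fun j _ => (integrable_truncGauss ℓ θ K (node j)).const_mul _
  have hsum := integrable_finsetSum _ hterm
  refine ⟨∑ j, (∫ φ, w j φ ∂g) • e j, Submodule.sum_mem _ fun j _ =>
    Submodule.smul_mem _ _ (Submodule.subset_span (mem_range_self j)), ?_⟩
  have hL1 : ∑ j, (∫ φ, w j φ ∂g) • e j = hsum.toL1 :=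
    sum_smul_toL1 _ (fun j => integrable_truncGauss ℓ θ K (node j)) hsum
  rw [hL1, ← Integrable.toL1_sub _ _ hmix hsum, L1.norm_of_fun_eq_integral_norm,
    ← integral_wideGauss]
  refine integral_mono (hmix.sub hsum).norm (integrable_wideGauss _ _) fun z => ?_
  exact abs_mixDensity_sub_le ℓ θ K hw hinterp hg z

end Mixture

theorem exists_net_mixMeasure (ℓ : ℕ) (θ : Fin (2 * ℓ + 1) → ℂ) (K : ℕ) {ε : ℝ} (hε : 0 < ε)
    (hε1 : ε ≤ 1)
    (hK : Real.exp (-K) * Real.exp (18 * sqnorm _ θ) * 2 ^ (2 * ℓ + 1) ≤ ε / 4) :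
    ∃ t : Finset {g : Measure ℝ // IsProbOn01 g}, t.Nonempty ∧
      (t.card : ℝ) ≤ (6 / ε) ^ (2 * (ℓ * K) + 1) ∧
      ∀ g, IsProbOn01 g → ∃ g' ∈ t, dTV (mixMeasure ℓ θ g) (mixMeasure ℓ θ g') ≤ ε := by
  have hprob : ∀ g : {g : Measure ℝ // IsProbOn01 g}, IsProbabilityMeasure g.1 := fun g => g.2.1
  have : Nonempty {g : Measure ℝ // IsProbOn01 g} :=
    ⟨⟨Measure.dirac 0, inferInstance, by simp⟩⟩
  obtain ⟨W, hW, hrank, happrox⟩ := exists_submodule_approx_mixDensity ℓ θ K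
  obtain ⟨t, htne, htc, ht⟩ := exists_net_of_approx_submodule W
    (fun g : {g : Measure ℝ // IsProbOn01 g} => (integrable_mixDensity ℓ θ g.1).toL1) hε hε1
    (fun g => (norm_toL1_mixDensity ℓ θ g.1).le) fun g => by
      obtain ⟨y, hyW, hy⟩ := happrox g.1 g.2
      exact ⟨y, hyW, hy.trans hK⟩
  refine ⟨t, htne, htc.trans (pow_le_pow_right₀ ?_ hrank), fun g hg => ?_⟩
  · rw [le_div_iff₀ hε]
    linarith
  · obtain ⟨g', hg', hle⟩ := ht ⟨g, hg⟩
    have := hg.1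
    exact ⟨g', hg', (dTV_mixMeasure_le ℓ θ g g'.1).trans hle⟩

/-- uniform (over ‖θ‖ ≤ w ≤ a√(2ℓ+1)) total variation ε-covering of
{P_{θ,g} : g ∈ 𝔐([0,1])} of log-cardinality at most C ℓ² (log(1/ε) + log(ℓ+1)). -/
theorem covering_of_Pf_dTV_uniform :
    ∀ a b : ℝ, 0 < a → 0 < b →
      ∃ C : ℝ, 0 < C ∧ ∃ ε₀ ∈ Set.Ioo (0 : ℝ) 1, ∀ ε ∈ Set.Ioc (0 : ℝ) ε₀,
        ∀ (ℓ : ℕ), 1 ≤ ℓ → Real.log (1 / ε) ≤ b * ℓ →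
          ∀ w : ℝ, w ≤ a * Real.sqrt (2 * (ℓ : ℝ) + 1) →
            ∀ θ : Fin (2 * ℓ + 1) → ℂ, Real.sqrt (sqnorm (2 * ℓ + 1) θ) ≤ w →
              ∃ N : ℕ, 1 ≤ N ∧
                Real.log N ≤ C * (ℓ : ℝ) ^ 2
                  * (Real.log (1 / ε) + Real.log ((ℓ : ℝ) + 1)) ∧
                ∃ ctr : Fin N → Measure (Fin (2 * ℓ + 1) → ℂ),
                  (∀ i, IsProbabilityMeasure (ctr i)) ∧
                  ∀ g : Measure ℝ, IsProbOn01 g →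
                    ∃ i, dTV (mixMeasure ℓ θ g) (ctr i) ≤ ε := by
  intro a b ha hb
  set c : ℝ := 2 * b + 3 * (1 + 18 * a ^ 2) + 1 with hc
  have hc0 : 0 < c := by positivity
  refine ⟨2 * (2 * c + 1), by positivity, 1 / 10, by norm_num, ?_⟩
  rintro ε ⟨hε, hε10⟩ ℓ hℓ hb' w hw θ hθ
  have hℓ1 : (1 : ℝ) ≤ ℓ := by exact_mod_cast hℓ
  have hlog : Real.log (1 / ε) = -Real.log ε := by rw [one_div, Real.log_inv]
  have hlog10 : Real.log 10 ≤ Real.log (1 / ε) := by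
    refine Real.log_le_log (by norm_num) ?_
    rw [le_div_iff₀ hε]
    linarith
  have hconst : ∀ x : ℝ, 0 < x → x ≤ 10 → Real.log (x / ε) ≤ 2 * Real.log (1 / ε) := by
    intro x hx hx10
    have := Real.log_le_log hx hx10
    rw [Real.log_div hx.ne' hε.ne']
    linarith
  have hsq : sqnorm (2 * ℓ + 1) θ ≤ a ^ 2 * (2 * ℓ + 1) := by
    have h := (Real.sqrt_le_left (by positivity)).1 (hθ.trans hw)
    rwa [mul_pow, Real.sq_sqrt (by positivity)] at h
  set K : ℕ := ⌈2 * Real.log (1 / ε) + (1 + 18 * a ^ 2) * (2 * ℓ + 1)⌉₊ with hK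
  have hKle : 2 * Real.log (1 / ε) + (1 + 18 * a ^ 2) * (2 * ℓ + 1) ≤ K := Nat.le_ceil _
  have hlog0 : 0 ≤ Real.log (1 / ε) := (Real.log_nonneg (by norm_num)).trans hlog10
  have hKub : (K : ℝ) ≤ c * ℓ := by
    have := Nat.ceil_lt_add_one
      (show 0 ≤ 2 * Real.log (1 / ε) + (1 + 18 * a ^ 2) * (2 * (ℓ : ℝ) + 1) by positivity)
    have ha' : (1 + 18 * a ^ 2) * (2 * (ℓ : ℝ) + 1) ≤ (1 + 18 * a ^ 2) * (3 * ℓ) := by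
      gcongr
      linarith
    rw [hc]
    linarith
  have herr : Real.exp (-K) * Real.exp (18 * sqnorm _ θ) * 2 ^ (2 * ℓ + 1) ≤ ε / 4 := by
    have h2 : (2 : ℝ) ^ (2 * ℓ + 1) ≤ Real.exp (2 * ℓ + 1) := by
      have : (2 : ℝ) ≤ Real.exp 1 := by linarith [Real.add_one_le_exp (1 : ℝ)]
      calc (2 : ℝ) ^ (2 * ℓ + 1) ≤ Real.exp 1 ^ (2 * ℓ + 1) := by gcongr
        _ = Real.exp (2 * ℓ + 1) := by rw [← Real.exp_nat_mul]; push_cast; ring_nf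
    calc _ ≤ Real.exp (-K) * Real.exp (18 * sqnorm _ θ) * Real.exp (2 * ℓ + 1) := by gcongr
      _ = Real.exp (-K + 18 * sqnorm _ θ + (2 * ℓ + 1)) := by rw [← Real.exp_add, ← Real.exp_add]
      _ ≤ Real.exp (-Real.log (4 / ε)) := by
          apply Real.exp_le_exp.2
          linarith [hconst 4 (by norm_num) (by norm_num)]
      _ = ε / 4 := by rw [Real.exp_neg, Real.exp_log (by positivity), inv_div]
  obtain ⟨t, htne, htc, ht⟩ := exists_net_mixMeasure ℓ θ K hε (by linarith) herr
  refine ⟨t.card, htne.card_pos, ?_, fun i => mixMeasure ℓ θ (t.equivFin.symm i).1.1,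
    fun i => ?_, fun g hg => ?_⟩
  · have hcard : (0 : ℝ) < t.card := by exact_mod_cast htne.card_pos
    have hdim : ((2 * (ℓ * K) + 1 : ℕ) : ℝ) ≤ (2 * c + 1) * (ℓ : ℝ) ^ 2 := by
      push_cast
      nlinarith
    have hlogl : 0 ≤ Real.log ((ℓ : ℝ) + 1) := Real.log_nonneg (by linarith)
    calc Real.log t.card ≤ Real.log ((6 / ε) ^ (2 * (ℓ * K) + 1)) := Real.log_le_log hcard htc
      _ = ((2 * (ℓ * K) + 1 : ℕ) : ℝ) * Real.log (6 / ε) := Real.log_pow _ _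
      _ ≤ ((2 * c + 1) * (ℓ : ℝ) ^ 2) * (2 * Real.log (1 / ε)) := by
          refine mul_le_mul hdim (hconst 6 (by norm_num) (by norm_num)) ?_ (by positivity)
          exact Real.log_nonneg (by rw [le_div_iff₀ hε]; linarith)
      _ = 2 * (2 * c + 1) * (ℓ : ℝ) ^ 2 * (Real.log (1 / ε) + 0) := by ring
      _ ≤ _ := by gcongr
  · have := (t.equivFin.symm i).1.2.1
    exact isProbabilityMeasure_mixMeasure ℓ θ _
  · obtain ⟨g', hg', hle⟩ := ht g hg
    refine ⟨t.equivFin ⟨g', hg'⟩, ?_⟩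
    simpa using hle
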